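/- Let p ≥ 1 and ψ ∈ C_{b,p}(ℝ^d). Then for every y ∈ ℝ^d, the convex hull of ψ satisfies conv ψ(y) = inf { ∫ψ dρ : ρ ∈ P_p(ℝ^d), δ_y ≼_c ρ }, where δ_y is the Dirac measure at y. -/

import Mathlib

open MeasureTheory Set Filter Topology
open scoped ENNReal

noncomputable section

/-- `ℝ^d`, modelled as Euclidean space. -/
abbrev Rd (d : ℕ) : Type := EuclideanSpace ℝ (Fin d)

/-- A Borel measure on `ℝ^d` has finite `p`-th moment. -/
def HasMomentP (p : ℝ) {d : ℕ} (ρ : Measure (Rd d)) : Prop :=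
  ∫⁻ y, ENNReal.ofReal (‖y‖ ^ p) ∂ρ ≠ ⊤

/-- `P_p(ℝ^d)`: Borel probability measures on `ℝ^d` with finite `p`-th moment. -/
abbrev Pp (p : ℝ) (d : ℕ) : Type :=
  {ρ : Measure (Rd d) // IsProbabilityMeasure ρ ∧ HasMomentP p ρ}

/-- Continuous test functions of growth of order at most `p`. -/
def GrowthP (p : ℝ) {d : ℕ} (f : Rd d → ℝ) : Prop :=
  Continuous f ∧ ∃ K : ℝ, ∀ y, |f y| ≤ K * (1 + ‖y‖ ^ p)

/-- The `p`-weak topology on `P_p(ℝ^d)`: the initial topology induced by integration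
against continuous functions of growth of order at most `p`. -/
instance PpTopology (p : ℝ) (d : ℕ) : TopologicalSpace (Pp p d) :=
  ⨅ f : {f : Rd d → ℝ // GrowthP p f},
    TopologicalSpace.induced (fun ρ : Pp p d => ∫ y, f.1 y ∂ρ.1) inferInstance

instance PpMeasurableSpace (p : ℝ) (d : ℕ) : MeasurableSpace (Pp p d) := borel _

/-- `C_{b,p}(ℝ^d)`: continuous functions bounded from below by a constant and bounded
above by `K (1 + |y - y₀|^p)` for some `K > 0`, `y₀`. -/
def Cbp (p : ℝ) {d : ℕ} (ψ : Rd d → ℝ) : Prop :=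
  Continuous ψ ∧ (∃ c : ℝ, ∀ y, c ≤ ψ y) ∧
    ∃ K : ℝ, 0 < K ∧ ∃ y₀ : Rd d, ∀ y, ψ y ≤ K * (1 + ‖y - y₀‖ ^ p)

open scoped Classical in
/-- The nonnegative part of an extended real, as an extended nonnegative real. -/
def erealToENN (x : EReal) : ℝ≥0∞ := if x = ⊤ then ⊤ else ENNReal.ofReal x.toReal

/-- Canonical extended integral of an `EReal`-valued function: the lower integral of the
positive part minus the lower integral of the negative part. -/
def eInt {α : Type*} [MeasurableSpace α] (μ : Measure α) (f : α → EReal) : EReal :=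
  ((∫⁻ x, erealToENN (f x) ∂μ : ℝ≥0∞) : EReal) -
    ((∫⁻ x, erealToENN (-(f x)) ∂μ : ℝ≥0∞) : EReal)

/-- The convex order on measures on `ℝ^d`: `ρ₁ ≼_c ρ₂` iff `∫ f dρ₁ ≤ ∫ f dρ₂` for every
convex function `f : ℝ^d → ℝ` (integrals taken in the extended sense). -/
def ConvexOrder {d : ℕ} (ρ₁ ρ₂ : Measure (Rd d)) : Prop :=
  ∀ f : Rd d → ℝ, ConvexOn ℝ univ f →
    eInt ρ₁ (fun y => (f y : EReal)) ≤ eInt ρ₂ (fun y => (f y : EReal))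

/-- Coordinatewise increasing functions on `ℝ^d`. -/
def CoordMono {d : ℕ} (f : Rd d → ℝ) : Prop :=
  ∀ y z : Rd d, (∀ i, y i ≤ z i) → f y ≤ f z

/-- The increasing convex order on measures on `ℝ^d`. -/
def IcxOrder {d : ℕ} (ρ₁ ρ₂ : Measure (Rd d)) : Prop :=
  ∀ f : Rd d → ℝ, ConvexOn ℝ univ f → CoordMono f →
    eInt ρ₁ (fun y => (f y : EReal)) ≤ eInt ρ₂ (fun y => (f y : EReal))

/-- `π` is a coupling of `μ` and `ν`. -/
def IsCoupling {X Y : Type*} [MeasurableSpace X] [MeasurableSpace Y]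
    (π : Measure (X × Y)) (μ : Measure X) (ν : Measure Y) : Prop :=
  IsProbabilityMeasure π ∧ π.map Prod.fst = μ ∧ π.map Prod.snd = ν

open scoped Classical in
/-- Disintegration of a measure on a product space with respect to its first marginal. -/
def disint {X : Type*} [MeasurableSpace X] {Y : Type*} [MeasurableSpace Y]
    [StandardBorelSpace Y] [Nonempty Y] (π : Measure (X × Y)) :
    ProbabilityTheory.Kernel X Y :=
  if h : IsFiniteMeasure π then (haveI := h; π.condKernel) else 0

/-- The primal weak optimal transport value `inf_{π ∈ Π(μ,ν)} ∫ C(x, π_x) dμ(x)`. -/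
def primal {X : Type*} [MeasurableSpace X] {d : ℕ}
    (μ : Measure X) (ν : Measure (Rd d)) (C : X → Measure (Rd d) → ℝ≥0∞) : ℝ≥0∞ :=
  ⨅ π : {π : Measure (X × Rd d) // IsCoupling π μ ν}, ∫⁻ x, C x (disint π.1 x) ∂μ

/-- The `C`-conjugate `ψ^C (x) = inf_{ρ ∈ P_p} ρ(ψ) + C(x, ρ)`. -/
def conj (p : ℝ) {X : Type*} [MeasurableSpace X] {d : ℕ}
    (C : X → Measure (Rd d) → ℝ≥0∞) (ψ : Rd d → ℝ) (x : X) : EReal :=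
  ⨅ ρ : Pp p d, ((∫ y, ψ y ∂ρ.1 : ℝ) : EReal) + ((C x ρ.1 : ℝ≥0∞) : EReal)

/-- The dual value `μ(ψ^C) - ν(ψ)`. -/
def dualVal (p : ℝ) {X : Type*} [MeasurableSpace X] {d : ℕ}
    (μ : Measure X) (ν : Measure (Rd d)) (C : X → Measure (Rd d) → ℝ≥0∞)
    (ψ : Rd d → ℝ) : EReal :=
  eInt μ (conj p C ψ) - ((∫ y, ψ y ∂ν : ℝ) : EReal)

end

section ExtendedIntegral

variable {α : Type*} [MeasurableSpace α] {μ : Measure α} {f g : α → ℝ}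

lemma erealToENN_coe (r : ℝ) : erealToENN (r : EReal) = ENNReal.ofReal r := by
  simp [erealToENN]

lemma eInt_coe_mono (h : ∀ x, f x ≤ g x) :
    eInt μ (fun x => (f x : EReal)) ≤ eInt μ (fun x => (g x : EReal)) := by
  simp only [eInt, ← EReal.coe_neg, erealToENN_coe]
  refine EReal.sub_le_sub ?_ ?_
  · exact EReal.coe_ennreal_le_coe_ennreal_iff.2
      (lintegral_mono fun x => ENNReal.ofReal_le_ofReal (h x))
  · exact EReal.coe_ennreal_le_coe_ennreal_iff.2
      (lintegral_mono fun x => ENNReal.ofReal_le_ofReal (neg_le_neg (h x)))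

lemma eInt_coe_of_integrable (hf : Integrable f μ) :
    eInt μ (fun x => (f x : EReal)) = ((∫ x, f x ∂μ : ℝ) : EReal) := by
  simp only [eInt, ← EReal.coe_neg, erealToENN_coe]
  have hpos : ∫⁻ x, ENNReal.ofReal (f x) ∂μ ≠ ⊤ := hf.lintegral_lt_top.ne
  have hneg : ∫⁻ x, ENNReal.ofReal (-f x) ∂μ ≠ ⊤ := hf.neg.lintegral_lt_top.ne
  rw [integral_eq_lintegral_pos_part_sub_lintegral_neg_part hf, EReal.coe_sub,
    EReal.coe_ennreal_toReal hpos, EReal.coe_ennreal_toReal hneg]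

lemma eInt_coe_dirac [MeasurableSingletonClass α] (a : α) :
    eInt (Measure.dirac a) (fun x => (f x : EReal)) = (f a : EReal) := by
  rw [eInt_coe_of_integrable (integrable_dirac (by simp)), integral_dirac]

end ExtendedIntegral

section Moments

variable {d : ℕ} {p : ℝ} {ρ : Measure (Rd d)}

lemma HasMomentP.memLp_id (hp : 1 ≤ p) (hρ : HasMomentP p ρ) :
    MemLp (fun z : Rd d => z) (ENNReal.ofReal p) ρ := by
  have hp0 : 0 < p := by linarith
  rw [← integrable_norm_rpow_iff (f := fun z : Rd d => z) aestronglyMeasurable_id (by simpa using hp0)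
    ENNReal.ofReal_ne_top, ENNReal.toReal_ofReal hp0.le]
  refine (lintegral_ofReal_ne_top_iff_integrable ?_ ?_).1 hρ
  · exact (by fun_prop : Measurable fun z : Rd d => ‖z‖ ^ p).aestronglyMeasurable
  · exact Eventually.of_forall fun z => by positivity

lemma HasMomentP.integrable_id [IsFiniteMeasure ρ] (hp : 1 ≤ p) (hρ : HasMomentP p ρ) :
    Integrable (fun z : Rd d => z) ρ :=
  (hρ.memLp_id hp).integrable (by simpa using hp)

lemma Cbp.integrable [IsFiniteMeasure ρ] {ψ : Rd d → ℝ} (hp : 1 ≤ p) (hψ : Cbp p ψ)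
    (hρ : HasMomentP p ρ) : Integrable ψ ρ := by
  obtain ⟨hcont, ⟨c, hc⟩, K, -, y₀, hK⟩ := hψ
  have hpow : Integrable (fun z : Rd d => ‖z - y₀‖ ^ p) ρ := by
    have h := ((hρ.memLp_id hp).sub (memLp_const y₀)).integrable_norm_rpow'
    simpa [ENNReal.toReal_ofReal (by linarith : 0 ≤ p)] using h
  exact integrable_of_le_of_le hcont.aestronglyMeasurable (Eventually.of_forall hc)
    (Eventually.of_forall hK) (integrable_const c) (((integrable_const 1).add hpow).const_mul K)

lemma hasMomentP_dirac (y : Rd d) : HasMomentP p (Measure.dirac y) := by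
  simp [HasMomentP]

lemma HasMomentP.add {ρ' : Measure (Rd d)} (hρ : HasMomentP p ρ) (hρ' : HasMomentP p ρ') :
    HasMomentP p (ρ + ρ') := by
  rw [HasMomentP, lintegral_add_measure]
  exact ENNReal.add_ne_top.2 ⟨hρ, hρ'⟩

lemma HasMomentP.smul {c : ℝ≥0∞} (hc : c ≠ ⊤) (hρ : HasMomentP p ρ) :
    HasMomentP p (c • ρ) := by
  rw [HasMomentP, lintegral_smul_measure]
  exact ENNReal.mul_ne_top hc hρ

end Moments

section Mixtures

lemma integral_ofReal_smul_add_ofReal_smul {α E : Type*} [MeasurableSpace α]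
    [NormedAddCommGroup E] [NormedSpace ℝ E] {μ ν : Measure α} {f : α → E} {a b : ℝ}
    (ha : 0 ≤ a) (hb : 0 ≤ b) (hμ : Integrable f μ) (hν : Integrable f ν) :
    ∫ x, f x ∂(ENNReal.ofReal a • μ + ENNReal.ofReal b • ν) =
      a • ∫ x, f x ∂μ + b • ∫ x, f x ∂ν := by
  rw [integral_add_measure (hμ.smul_measure ENNReal.ofReal_ne_top)
    (hν.smul_measure ENNReal.ofReal_ne_top), integral_smul_measure, integral_smul_measure,
    ENNReal.toReal_ofReal ha, ENNReal.toReal_ofReal hb]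

/-- The mixture `a ρ₁ + b ρ₂` of two probability measures with finite `p`-th moment. -/
noncomputable def Pp.mix {p : ℝ} {d : ℕ} (ρ₁ ρ₂ : Pp p d) {a b : ℝ} (ha : 0 ≤ a) (hb : 0 ≤ b)
    (hab : a + b = 1) : Pp p d :=
  ⟨ENNReal.ofReal a • ρ₁.1 + ENNReal.ofReal b • ρ₂.1, by
    have := ρ₁.2.1
    have := ρ₂.2.1
    constructor
    simp [← ENNReal.ofReal_add ha hb, hab],
    (ρ₁.2.2.smul ENNReal.ofReal_ne_top).add (ρ₂.2.2.smul ENNReal.ofReal_ne_top)⟩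

end Mixtures

section ConvexOrder

variable {d : ℕ} {y : Rd d} {ρ : Measure (Rd d)}

lemma ConvexOn.exists_affine_minorant_of_lt {f : Rd d → ℝ} (hf : ConvexOn ℝ univ f) {a : ℝ}
    (ha : a < f y) :
    ∃ (L : Rd d →L[ℝ] ℝ) (c : ℝ), (∀ z, L z + c ≤ f z) ∧ L y + c = a := by
  obtain ⟨L, c, hle, heq⟩ := ConvexOn.exists_affine_le_of_lt (𝕜 := ℝ) (mem_univ y) ha
    isClosed_univ (hf.locallyLipschitz.continuous.lowerSemicontinuous.lowerSemicontinuousOn _) hf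
  exact ⟨L, c, fun z => by simpa using hle ⟨z, mem_univ z⟩, by simpa using heq⟩

lemma integrable_affine [IsFiniteMeasure ρ] (hid : Integrable (fun z : Rd d => z) ρ)
    (L : Rd d →L[ℝ] ℝ) (c : ℝ) : Integrable (fun z => L z + c) ρ :=
  (L.integrable_comp hid).add (integrable_const c)

/-- A measure with barycenter `y` dominates `δ_y` in the convex order. -/
lemma convexOrder_dirac_of_integral_eq [IsProbabilityMeasure ρ]
    (hid : Integrable (fun z : Rd d => z) ρ) (hy : ∫ z, z ∂ρ = y) :
    ConvexOrder (Measure.dirac y) ρ := by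
  intro f hf
  rw [eInt_coe_dirac]
  refine EReal.ge_of_forall_gt_iff_ge.1 fun a ha => ?_
  obtain ⟨L, c, hle, heq⟩ := hf.exists_affine_minorant_of_lt (EReal.coe_lt_coe_iff.1 ha)
  have hint : ∫ z, (L z + c) ∂ρ = a := by
    rw [integral_add (L.integrable_comp hid) (integrable_const c), L.integral_comp_comm hid, hy]
    simpa using heq
  calc (a : EReal) = eInt ρ (fun z => ((L z + c : ℝ) : EReal)) := by
        rw [eInt_coe_of_integrable (integrable_affine hid L c), hint]
    _ ≤ _ := eInt_coe_mono hle

lemma ConvexOrder.le_integral_of_convexOn_le [IsFiniteMeasure ρ]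
    (hρ : ConvexOrder (Measure.dirac y) ρ) (hid : Integrable (fun z : Rd d => z) ρ)
    {φ ψ : Rd d → ℝ} (hφ : ConvexOn ℝ univ φ) (hle : ∀ z, φ z ≤ ψ z) (hψ : Integrable ψ ρ) :
    φ y ≤ ∫ z, ψ z ∂ρ := by
  refine le_of_forall_lt_imp_le_of_dense fun a ha => ?_
  obtain ⟨L, c, hLφ, heq⟩ := hφ.exists_affine_minorant_of_lt ha
  have hconv : ConvexOn ℝ univ (fun z => L z + c) :=
    (L.toLinearMap.convexOn convex_univ).add_const c
  have h := hρ _ hconv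
  rw [eInt_coe_dirac, eInt_coe_of_integrable (integrable_affine hid L c),
    EReal.coe_le_coe_iff, heq] at h
  exact h.trans (integral_mono (integrable_affine hid L c) hψ fun z => (hLφ z).trans (hle z))

end ConvexOrder

section BarycentricEnvelope

variable {d : ℕ} {p : ℝ} {ψ : Rd d → ℝ}

/-- The infimum of `∫ ψ dρ` over the `ρ ∈ P_p(ℝ^d)` with barycenter `y`. -/
noncomputable def barycentricEnvelope (p : ℝ) {d : ℕ} (ψ : Rd d → ℝ) (y : Rd d) : ℝ :=
  ⨅ ρ : {ρ : Pp p d // ∫ z, z ∂ρ.1 = y}, ∫ z, ψ z ∂ρ.1.1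

/-- The Dirac measure at `y`, as a measure with barycenter `y`. -/
noncomputable def diracBarycenter (p : ℝ) {d : ℕ} (y : Rd d) : {ρ : Pp p d // ∫ z, z ∂ρ.1 = y} :=
  ⟨⟨Measure.dirac y, inferInstance, hasMomentP_dirac y⟩, integral_dirac _ y⟩

instance (y : Rd d) : Nonempty {ρ : Pp p d // ∫ z, z ∂ρ.1 = y} := ⟨diracBarycenter p y⟩

lemma Cbp.bddBelow_range_integral (hp : 1 ≤ p) (hψ : Cbp p ψ) (y : Rd d) :
    BddBelow (range fun ρ : {ρ : Pp p d // ∫ z, z ∂ρ.1 = y} => ∫ z, ψ z ∂ρ.1.1) := by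
  obtain ⟨c, hc⟩ := hψ.2.1
  refine ⟨c, ?_⟩
  rintro _ ⟨ρ, rfl⟩
  have := ρ.1.2.1
  simpa using integral_mono (integrable_const c) (hψ.integrable hp ρ.1.2.2) hc

lemma barycentricEnvelope_le (hp : 1 ≤ p) (hψ : Cbp p ψ) (y : Rd d) :
    barycentricEnvelope p ψ y ≤ ψ y :=
  (ciInf_le (hψ.bddBelow_range_integral hp y) (diracBarycenter p y)).trans_eq
    (integral_dirac ψ y)

lemma convexOn_barycentricEnvelope (hp : 1 ≤ p) (hψ : Cbp p ψ) :
    ConvexOn ℝ univ (barycentricEnvelope p ψ) := by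
  refine ⟨convex_univ, fun x _ y _ a b ha hb hab => le_of_forall_pos_le_add fun ε hε => ?_⟩
  obtain ⟨⟨ρ₁, h₁⟩, hlt₁⟩ := exists_lt_of_ciInf_lt
    (lt_add_of_pos_right (barycentricEnvelope p ψ x) hε)
  obtain ⟨⟨ρ₂, h₂⟩, hlt₂⟩ := exists_lt_of_ciInf_lt
    (lt_add_of_pos_right (barycentricEnvelope p ψ y) hε)
  have := ρ₁.2.1
  have := ρ₂.2.1
  have hbary : ∫ z, z ∂(Pp.mix ρ₁ ρ₂ ha hb hab).1 = a • x + b • y := by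
    rw [Pp.mix, integral_ofReal_smul_add_ofReal_smul ha hb (ρ₁.2.2.integrable_id hp)
      (ρ₂.2.2.integrable_id hp), h₁, h₂]
  calc barycentricEnvelope p ψ (a • x + b • y)
      ≤ ∫ z, ψ z ∂(Pp.mix ρ₁ ρ₂ ha hb hab).1 :=
        ciInf_le (hψ.bddBelow_range_integral hp _) ⟨Pp.mix ρ₁ ρ₂ ha hb hab, hbary⟩
    _ = a • ∫ z, ψ z ∂ρ₁.1 + b • ∫ z, ψ z ∂ρ₂.1 :=
        integral_ofReal_smul_add_ofReal_smul ha hb (hψ.integrable hp ρ₁.2.2)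
          (hψ.integrable hp ρ₂.2.2)
    _ ≤ a • (barycentricEnvelope p ψ x + ε) + b • (barycentricEnvelope p ψ y + ε) := by
        gcongr
    _ = a • barycentricEnvelope p ψ x + b • barycentricEnvelope p ψ y + ε := by
        simp only [smul_eq_mul]
        linear_combination ε * hab

end BarycentricEnvelope

/-- **Representation of the convex hull** (Lemma 2 (i)): for `ψ ∈ C_{b,p}(ℝ^d)`,
`conv ψ (y) = inf { ρ(ψ) : ρ ∈ P_p(ℝ^d), δ_y ≼_c ρ }`. -/
theorem convexHull_eq_inf_over_convexOrder
    {d : ℕ} {p : ℝ} (hp : 1 ≤ p) (ψ : Rd d → ℝ) (hψ : Cbp p ψ) (y : Rd d) :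
    (⨆ φ : {φ : Rd d → ℝ // ConvexOn ℝ Set.univ φ ∧ ∀ z, φ z ≤ ψ z}, (φ.1 y : EReal))
      = ⨅ ρ : {ρ : Pp p d // ConvexOrder (Measure.dirac y) ρ.1},
          ((∫ z, ψ z ∂ρ.1.1 : ℝ) : EReal) := by
  refine le_antisymm ?_ ?_
  · refine iSup_le fun φ => le_iInf fun ρ => EReal.coe_le_coe_iff.2 ?_
    have := ρ.1.2.1
    exact ρ.2.le_integral_of_convexOn_le (ρ.1.2.2.integrable_id hp) φ.2.1 φ.2.2
      (hψ.integrable hp ρ.1.2.2)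
  · refine le_iSup_of_le
      ⟨barycentricEnvelope p ψ, convexOn_barycentricEnvelope hp hψ,
        barycentricEnvelope_le hp hψ⟩ ?_
    refine EReal.le_of_forall_lt_iff_le.1 fun r hr => ?_
    obtain ⟨⟨ρ, hbary⟩, hlt⟩ := exists_lt_of_ciInf_lt (EReal.coe_lt_coe_iff.1 hr)
    have := ρ.2.1
    have hord := convexOrder_dirac_of_integral_eq (ρ.2.2.integrable_id hp) hbary
    exact (iInf_le _ ⟨ρ, hord⟩).trans (EReal.coe_le_coe_iff.2 hlt.le)
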